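/- arXiv:1308.4462 — 2 statements merged into one kernel-verified Lean document; each statement's English description precedes it below -/
import Mathlib

section
/- Assume (B2) and fix a probability measure σ on E. Then for every ω ∈ Ω: (i) for every A ∈ 𝓔 the limit η^ω(A) = lim_{n→∞} Φ_n^{z^{-n}ω}(σ)(A) exists and η^ω is a probability measure on (E,𝓔), the map ω ↦ η^ω(A) being measurable for each A; and (ii) for every x ∈ E the limit h(ω,x) = lim_{n→∞} Q_n^ω(1)(x) / Φ_n^{z^{-n}ω}(σ)(Q_n^ω(1)) exists, and the resulting function h : Ω×E → ℝ is 𝓕⊗𝓔-measurable. -/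
open MeasureTheory ENNReal Filter Topology

noncomputable section

/-- The environment space `Ω = H^ℤ`. -/
abbrev Env (H : Type*) := ℤ → H

/-- The shift operator `z`: `(zω)(n) = ω(n+1)`. -/
def shift {H : Type*} (ω : Env H) : Env H := fun n => ω (n + 1)

/-- The inverse shift `z⁻¹`: `(z⁻¹ω)(n) = ω(n-1)`. -/
def shiftInv {H : Type*} (ω : Env H) : Env H := fun n => ω (n - 1)

/-- Iterates `z^{-k}` of the inverse shift. -/
def zitInv {H : Type*} : ℕ → Env H → Env H
  | 0, ω => ω
  | n + 1, ω => shiftInv (zitInv n ω)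

variable {H E : Type*} [MeasurableSpace H] [MeasurableSpace E]

/-- Iterates `z^k` of the shift. -/
def zit {H : Type*} : ℕ → Env H → Env H
  | 0, ω => ω
  | n + 1, ω => shift (zit n ω)

/-- The sub-Markov kernel `Q^ω(x,dx') = W(ω,x) M^ω(x,dx')`. -/
def Qk (M : Env H → E → Measure E) (W : Env H → E → ℝ) (ω : Env H) (x : E) :
    Measure E := ENNReal.ofReal (W ω x) • M ω x

/-- The compositions `Q_n^ω = Q^ω Q^{zω} ⋯ Q^{z^{n-1}ω}` (with `Q_0` the identity). -/
def Qn (M : Env H → E → Measure E) (W : Env H → E → ℝ) :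
    ℕ → Env H → E → Measure E
  | 0, _, x => Measure.dirac x
  | n + 1, ω, x => (Qn M W n ω x).bind (Qk M W (zit n ω))

/-- The total mass `σ Q_n^ω(1)`. -/
def QnMass (M : Env H → E → Measure E) (W : Env H → E → ℝ)
    (n : ℕ) (ω : Env H) (σ : Measure E) : ℝ≥0∞ :=
  (σ.bind (Qn M W n ω)) Set.univ

/-- `Φ_n^ω(σ)(A) = σQ_n^ω(A) / σQ_n^ω(1)`. -/
def PhiSet (M : Env H → E → Measure E) (W : Env H → E → ℝ)
    (n : ℕ) (ω : Env H) (σ : Measure E) (A : Set E) : ℝ≥0∞ :=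
  (σ.bind (Qn M W n ω)) A / QnMass M W n ω σ

/-- `Φ_n^ω(σ)(φ)` for a `ℝ≥0∞`-valued function `φ`. -/
def PhiFun (M : Env H → E → Measure E) (W : Env H → E → ℝ)
    (n : ℕ) (ω : Env H) (σ : Measure E) (φ : E → ℝ≥0∞) : ℝ≥0∞ :=
  (∫⁻ y, φ y ∂(σ.bind (Qn M W n ω))) / QnMass M W n ω σ

/-- The ratio `Q_n^ω(1)(x) / Φ_n^{z^{-n}ω}(σ)(Q_n^ω(1))` whose limit defines `h(ω,x)`. -/
def ratioH (M : Env H → E → Measure E) (W : Env H → E → ℝ) (σ : Measure E)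
    (n : ℕ) (ω : Env H) (x : E) : ℝ≥0∞ :=
  (Qn M W n ω x) Set.univ /
    PhiFun M W n (zitInv n ω) σ (fun y => (Qn M W n ω y) Set.univ)

set_option linter.unusedSectionVars false

open ProbabilityTheory in
lemma aux_core {E : Type*} [MeasurableSpace E] (K ν : Measure E)
    (εm εp : ℝ) (hεm : 0 < εm) (hεmp : εm ≤ εp)
    (hl : ENNReal.ofReal εm • ν ≤ K) (hu : K ≤ ENNReal.ofReal εp • ν)
    (F G : E → ℝ≥0∞) (hF : Measurable F) (hG : Measurable G)
    (hv0 : 0 < ∫⁻ y, G y ∂ν) (hv : ∫⁻ y, G y ∂ν < ∞)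
    (a b : ℝ) (ha : 0 ≤ a) (hab : a ≤ b)
    (h1 : ∀ y, ENNReal.ofReal a * G y ≤ F y) (h2 : ∀ y, F y ≤ ENNReal.ofReal b * G y)
    (c : ℝ) (hc : c = (∫⁻ y, F y ∂ν).toReal / (∫⁻ y, G y ∂ν).toReal) :
    ENNReal.ofReal (εm / εp * c + (1 - εm / εp) * a) * ∫⁻ y, G y ∂K ≤ ∫⁻ y, F y ∂K ∧
    ∫⁻ y, F y ∂K ≤ ENNReal.ofReal (εm / εp * c + (1 - εm / εp) * b) * ∫⁻ y, G y ∂K ∧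
    a ≤ c ∧ c ≤ b := by
  have hεp : 0 < εp := hεm.trans_le hεmp
  have gen : ∀ F₁ F₂ : E → ℝ≥0∞, Measurable F₁ → Measurable F₂ → (∀ y, F₁ y ≤ F₂ y) →
      ∫⁻ y, F₁ y ∂K + ENNReal.ofReal εm * ∫⁻ y, F₂ y ∂ν ≤
      ∫⁻ y, F₂ y ∂K + ENNReal.ofReal εm * ∫⁻ y, F₁ y ∂ν := by
    intro F₁ F₂ m1 m2 h
    have e : ∀ y, F₂ y = F₁ y + (F₂ y - F₁ y) := fun y => (add_tsub_cancel_of_le (h y)).symm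
    have e' : ∀ μ : Measure E, ∫⁻ y, F₂ y ∂μ = ∫⁻ y, F₁ y ∂μ + ∫⁻ y, (F₂ y - F₁ y) ∂μ := by
      intro μ
      rw [← lintegral_add_left m1]
      exact lintegral_congr e
    have e3 : ENNReal.ofReal εm * ∫⁻ y, (F₂ y - F₁ y) ∂ν ≤ ∫⁻ y, (F₂ y - F₁ y) ∂K := by
      have := lintegral_mono' hl (le_refl (fun y => F₂ y - F₁ y))
      simpa [lintegral_smul_measure] using this
    rw [e' K, e' ν, mul_add]
    calc _ = ∫⁻ y, F₁ y ∂K + ENNReal.ofReal εm * ∫⁻ y, F₁ y ∂ν +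
          ENNReal.ofReal εm * ∫⁻ y, (F₂ y - F₁ y) ∂ν := by ring
      _ ≤ ∫⁻ y, F₁ y ∂K + ENNReal.ofReal εm * ∫⁻ y, F₁ y ∂ν + ∫⁻ y, (F₂ y - F₁ y) ∂K := by
          gcongr
      _ = _ := by ring
  have g1 := gen (fun y => ENNReal.ofReal a * G y) F (hG.const_mul _) hF h1
  have g2 := gen F (fun y => ENNReal.ofReal b * G y) hF (hG.const_mul _) h2
  simp only [lintegral_const_mul _ hG] at g1 g2
  have i1 : ∀ μ : Measure E, ENNReal.ofReal a * ∫⁻ y, G y ∂μ ≤ ∫⁻ y, F y ∂μ := by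
    intro μ; rw [← lintegral_const_mul _ hG]; exact lintegral_mono h1
  have i2 : ∀ μ : Measure E, ∫⁻ y, F y ∂μ ≤ ENNReal.ofReal b * ∫⁻ y, G y ∂μ := by
    intro μ; rw [← lintegral_const_mul _ hG]; exact lintegral_mono h2
  have gu : ∫⁻ y, G y ∂K ≤ ENNReal.ofReal εp * ∫⁻ y, G y ∂ν := by
    have := lintegral_mono' hu (le_refl G)
    simpa [lintegral_smul_measure] using this
  have hgt : ∫⁻ y, G y ∂K ≠ ∞ := ne_top_of_le_ne_top (ENNReal.mul_ne_top ENNReal.ofReal_ne_top hv.ne) gu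
  have hft : ∫⁻ y, F y ∂ν ≠ ∞ := ne_top_of_le_ne_top (ENNReal.mul_ne_top ENNReal.ofReal_ne_top hv.ne) (i2 ν)
  have hkt : ∫⁻ y, F y ∂K ≠ ∞ := ne_top_of_le_ne_top (ENNReal.mul_ne_top ENNReal.ofReal_ne_top hgt) (i2 K)
  have j1 := i1 ν
  have j2 := i2 ν
  have hvpos : 0 < (∫⁻ y, G y ∂ν).toReal := ENNReal.toReal_pos hv0.ne' hv.ne
  rw [← ENNReal.ofReal_toReal hgt, ← ENNReal.ofReal_toReal hkt]
  rw [← ENNReal.ofReal_toReal hgt, ← ENNReal.ofReal_toReal hv.ne] at gu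
  rw [← ENNReal.ofReal_toReal hft, ← ENNReal.ofReal_toReal hv.ne] at j1 j2
  rw [← ENNReal.ofReal_toReal hgt, ← ENNReal.ofReal_toReal hkt, ← ENNReal.ofReal_toReal hft,
    ← ENNReal.ofReal_toReal hv.ne] at g1 g2
  have hg := ENNReal.toReal_nonneg (a := ∫⁻ y, G y ∂K)
  have hk := ENNReal.toReal_nonneg (a := ∫⁻ y, F y ∂K)
  have hf := ENNReal.toReal_nonneg (a := ∫⁻ y, F y ∂ν)
  generalize (∫⁻ y, G y ∂K).toReal = g at *
  generalize (∫⁻ y, F y ∂K).toReal = k at *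
  generalize (∫⁻ y, F y ∂ν).toReal = f at *
  generalize (∫⁻ y, G y ∂ν).toReal = v at *
  have hb : 0 ≤ b := ha.trans hab
  rw [← ENNReal.ofReal_mul (by positivity), ENNReal.ofReal_le_ofReal_iff (by positivity)] at gu j1 j2
  rw [← ENNReal.ofReal_mul (by positivity), ← ENNReal.ofReal_mul (by positivity),
    ← ENNReal.ofReal_mul (by positivity), ← ENNReal.ofReal_mul (by positivity),
    ← ENNReal.ofReal_add (by positivity) (by positivity),
    ← ENNReal.ofReal_add (by positivity) (by positivity),
    ENNReal.ofReal_le_ofReal_iff (by positivity)] at g1 g2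
  have hfc : f = c * v := by rw [hc]; field_simp
  have hac : a ≤ c := by rw [hc, le_div_iff₀ hvpos]; exact j1
  have hcb : c ≤ b := by rw [hc, div_le_iff₀ hvpos]; exact j2
  have hδ : εm / εp ≤ 1 := (div_le_one hεp).2 hεmp
  have hδ0 : 0 < εm / εp := by positivity
  have hδe : εm = εm / εp * εp := by field_simp
  generalize εm / εp = δ at *
  have hc0 : 0 ≤ c := ha.trans hac
  have hδ1 : 0 ≤ 1 - δ := by linarith
  rw [← ENNReal.ofReal_mul (by positivity), ← ENNReal.ofReal_mul (by positivity),
    ENNReal.ofReal_le_ofReal_iff hk, ENNReal.ofReal_le_ofReal_iff (by positivity)]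
  subst hfc
  have q1 := mul_le_mul_of_nonneg_left gu (mul_nonneg hδ0.le (sub_nonneg.2 hac))
  have q2 := mul_le_mul_of_nonneg_left gu (mul_nonneg hδ0.le (sub_nonneg.2 hcb))
  rw [hδe] at g1 g2
  refine ⟨by linarith, by linarith, hac, hcb⟩

lemma aux_seq (s : ℕ → ℝ) (e : ℕ → ℝ) (he : Tendsto e atTop (𝓝 0))
    (h : ∀ᶠ n in atTop, ∃ l u, u - l ≤ e n ∧ ∀ᶠ N in atTop, l ≤ s N ∧ s N ≤ u) :
    ∃ L, Tendsto s atTop (𝓝 L) := by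
  apply cauchySeq_tendsto_of_complete
  rw [Metric.cauchySeq_iff]
  intro ε hε
  obtain ⟨n, ⟨l, u, hlu, hN⟩, hn⟩ := (h.and (he.eventually (gt_mem_nhds hε))).exists
  obtain ⟨N, hN⟩ := eventually_atTop.1 hN
  refine ⟨N, fun p hp q hq => ?_⟩
  obtain ⟨a1, a2⟩ := hN p hp
  obtain ⟨b1, b2⟩ := hN q hq
  rw [Real.dist_eq, abs_lt]
  constructor <;> linarith

lemma aux_zit (n : ℕ) (ω : Env H) : zit n ω = fun k => ω (k + n) := by
  induction n with
  | zero => simp [zit]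
  | succ n ih => 
    funext k
    rw [zit, ih, shift]
    congr 1
    push_cast; ring

lemma aux_zitInv (n : ℕ) (ω : Env H) : zitInv n ω = fun k => ω (k - n) := by
  induction n with
  | zero => simp [zitInv]
  | succ n ih => 
    funext k
    rw [zitInv, ih, shiftInv]
    congr 1
    push_cast; ring

lemma aux_zit_zit (n m : ℕ) (ω : Env H) : zit m (zit n ω) = zit (n + m) ω := by
  simp only [aux_zit]
  funext k
  congr 1
  push_cast; ring

lemma aux_zit_zitInv (n m : ℕ) (ω : Env H) : zit m (zitInv (n + m) ω) = zitInv n ω := by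
  simp only [aux_zit, aux_zitInv]
  funext k
  congr 1
  push_cast; ring

lemma aux_zit_meas (n : ℕ) : Measurable (zit n : Env H → Env H) := by
  have : (zit n : Env H → Env H) = fun ω k => ω (k + n) := funext (aux_zit n)
  rw [this]
  exact measurable_pi_lambda _ fun k => measurable_pi_apply _

lemma aux_zitInv_meas (n : ℕ) : Measurable (zitInv n : Env H → Env H) := by
  have : (zitInv n : Env H → Env H) = fun ω k => ω (k - n) := funext (aux_zitInv n)
  rw [this]
  exact measurable_pi_lambda _ fun k => measurable_pi_apply _

lemma aux_Qk_meas (M : Env H → E → Measure E) (W : Env H → E → ℝ)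
    (hMmeas : Measurable fun p : Env H × E => M p.1 p.2)
    (hWmeas : Measurable fun p : Env H × E => W p.1 p.2) :
    Measurable fun p : Env H × E => Qk M W p.1 p.2 := by
  refine Measure.measurable_of_measurable_coe _ fun A hA => ?_
  simp only [Qk, Measure.smul_apply, smul_eq_mul]
  exact (hWmeas.ennreal_ofReal).mul ((Measure.measurable_coe hA).comp hMmeas)

open ProbabilityTheory in
lemma aux_Qn_joint (M : Env H → E → Measure E) (W : Env H → E → ℝ)
    (hMprob : ∀ ω x, IsProbabilityMeasure (M ω x))
    (hMmeas : Measurable fun p : Env H × E => M p.1 p.2)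
    (hWmeas : Measurable fun p : Env H × E => W p.1 p.2)
    (CW : ℝ) (hWbdd : ∀ ω x, W ω x ≤ CW) (n : ℕ) :
    Measurable fun p : Env H × E => Qn M W n p.1 p.2 := by
  suffices h : ∃ κ : Kernel (Env H × E) E, IsSFiniteKernel κ ∧ ∀ p, κ p = Qn M W n p.1 p.2 by
    obtain ⟨κ, -, h⟩ := h
    have : (fun p : Env H × E => Qn M W n p.1 p.2) = κ := funext fun p => (h p).symm
    rw [this]
    exact κ.measurable
  induction n with
  | zero =>
    refine ⟨Kernel.deterministic Prod.snd measurable_snd, inferInstance, fun p => ?_⟩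
    rw [Kernel.deterministic_apply, Qn]
  | succ n ih =>
    obtain ⟨κ, hκ, h⟩ := ih
    have hQ := aux_Qk_meas M W hMmeas hWmeas
    let η0 : Kernel (Env H × E) E := ⟨fun p => Qk M W p.1 p.2, hQ⟩
    have : IsFiniteKernel η0 := by
      refine ⟨ENNReal.ofReal CW, ENNReal.ofReal_lt_top, fun p => ?_⟩
      have := hMprob p.1 p.2
      change Qk M W p.1 p.2 Set.univ ≤ _
      simp only [Qk, Measure.smul_apply, smul_eq_mul, measure_univ, mul_one]
      exact ENNReal.ofReal_le_ofReal (hWbdd _ _)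
    have hc : Measurable fun q : (Env H × E) × E => (zit n q.1.1, q.2) :=
      ((aux_zit_meas n).comp (measurable_fst.comp measurable_fst)).prodMk measurable_snd
    let η := η0.comap _ hc
    refine ⟨(κ ⊗ₖ η).snd, inferInstance, fun p => ?_⟩
    ext A hA
    have hQ' : Measurable (Qk M W (zit n p.1)) := hQ.comp measurable_prodMk_left
    rw [Kernel.snd_apply' _ _ hA, Kernel.compProd_apply (measurable_snd hA), Qn,
      Measure.bind_apply hA hQ'.aemeasurable, h]
    rfl

lemma aux_Qn_add (M : Env H → E → Measure E) (W : Env H → E → ℝ)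
    (hQk : ∀ ω, Measurable (Qk M W ω)) (hQn : ∀ n ω, Measurable (Qn M W n ω))
    (n m : ℕ) (ω : Env H) (x : E) :
    Qn M W (n + m) ω x = (Qn M W n ω x).bind (Qn M W m (zit n ω)) := by
  induction m with
  | zero => 
    have : Qn M W 0 (zit n ω) = Measure.dirac := rfl
    rw [this, Measure.bind_dirac]; rfl
  | succ m ih =>
    rw [← add_assoc, Qn, ih, Measure.bind_bind (hQn _ _).aemeasurable (hQk _).aemeasurable,
      ← aux_zit_zit]
    rfl

lemma aux_contr (M : Env H → E → Measure E) (W : Env H → E → ℝ)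
    (hQk : ∀ ω, Measurable (Qk M W ω)) (hQn : ∀ n ω, Measurable (Qn M W n ω))
    (εm εp : ℝ) (hεm : 0 < εm) (hεmp : εm ≤ εp)
    (ν : Measure E) [IsProbabilityMeasure ν]
    (hB2b : ∀ ω x, ∀ A : Set E, MeasurableSet A →
        ENNReal.ofReal εm * ν A ≤ M ω x A ∧ M ω x A ≤ ENNReal.ofReal εp * ν A)
    (hB2d : ∀ n : ℕ, ∀ ω, ∀ σ : Measure E, IsProbabilityMeasure σ →
        0 < QnMass M W n ω σ ∧ QnMass M W n ω σ < ∞)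
    (φ : E → ℝ≥0∞) (hφ : Measurable φ) (a b : ℝ) (ha : 0 ≤ a) (hab : a ≤ b)
    (h1 : ∀ y, ENNReal.ofReal a ≤ φ y) (h2 : ∀ y, φ y ≤ ENNReal.ofReal b) (n : ℕ) (ω : Env H) :
    ∃ a' b' : ℝ, a ≤ a' ∧ a' ≤ b' ∧ b' ≤ b ∧ b' - a' ≤ (1 - εm / εp) ^ n * (b - a) ∧
      ∀ x, ENNReal.ofReal a' * Qn M W n ω x Set.univ ≤ ∫⁻ y, φ y ∂(Qn M W n ω x) ∧
        ∫⁻ y, φ y ∂(Qn M W n ω x) ≤ ENNReal.ofReal b' * Qn M W n ω x Set.univ := by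
  induction n generalizing ω with
  | zero =>
    refine ⟨a, b, le_rfl, hab, le_rfl, by simp, fun x => ?_⟩
    simp only [Qn, lintegral_dirac' _ hφ, measure_univ, mul_one]
    exact ⟨h1 x, h2 x⟩
  | succ n ih =>
    obtain ⟨a', b', haa, hab', hbb, hw, hx⟩ := ih (zit 1 ω)
    have ha' : 0 ≤ a' := ha.trans haa
    have hmass : QnMass M W n (zit 1 ω) ν = ∫⁻ y, Qn M W n (zit 1 ω) y Set.univ ∂ν := by
      rw [QnMass, Measure.bind_apply .univ (hQn _ _).aemeasurable]
    obtain ⟨hv0, hv⟩ := hB2d n (zit 1 ω) ν inferInstance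
    rw [hmass] at hv0 hv
    have hF : Measurable fun y => ∫⁻ u, φ u ∂(Qn M W n (zit 1 ω) y) :=
      (Measure.measurable_lintegral hφ).comp (hQn _ _)
    have hG : Measurable fun y => Qn M W n (zit 1 ω) y Set.univ :=
      (Measure.measurable_coe .univ).comp (hQn _ _)
    have core := fun x => aux_core (M ω x) ν εm εp hεm hεmp
      (Measure.le_iff.2 fun A hA => by simpa using (hB2b ω x A hA).1)
      (Measure.le_iff.2 fun A hA => by simpa using (hB2b ω x A hA).2)
      _ _ hF hG hv0 hv a' b' ha' hab' (fun y => (hx y).1) (fun y => (hx y).2) _ rfl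
    generalize (∫⁻ y, ∫⁻ u, φ u ∂(Qn M W n (zit 1 ω) y) ∂ν).toReal /
      (∫⁻ y, Qn M W n (zit 1 ω) y Set.univ ∂ν).toReal = c at core
    have hεp : 0 < εp := hεm.trans_le hεmp
    have hδ : εm / εp ≤ 1 := (div_le_one hεp).2 hεmp
    have hδ0 : 0 < εm / εp := by positivity
    generalize εm / εp = δ at *
    obtain ⟨x0⟩ : Nonempty E := nonempty_of_isProbabilityMeasure ν
    obtain ⟨-, -, hac, hcb⟩ := core x0
    have hδ1 : 0 ≤ 1 - δ := by linarith
    have hq : ∀ x, Qn M W (n + 1) ω x = (Qk M W ω x).bind (Qn M W n (zit 1 ω)) := by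
      intro x
      rw [add_comm, aux_Qn_add M W hQk hQn]
      congr 1
      change (Measure.dirac x).bind (Qk M W ω) = _
      exact Measure.dirac_bind (hQk ω) x
    refine ⟨δ * c + (1 - δ) * a', δ * c + (1 - δ) * b', by nlinarith, by nlinarith, by nlinarith,
      ?_, fun x => ?_⟩
    · have := mul_le_mul_of_nonneg_left hw hδ1
      rw [pow_succ]
      linarith
    · obtain ⟨c1, c2, -, -⟩ := core x
      rw [hq, Measure.lintegral_bind (hQn _ _).aemeasurable hφ.aemeasurable,
        Measure.bind_apply .univ (hQn _ _).aemeasurable, Qk, lintegral_smul_measure,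
        lintegral_smul_measure, smul_eq_mul, smul_eq_mul]
      constructor
      · rw [mul_left_comm]; gcongr
      · rw [mul_left_comm]; gcongr

lemma aux_phi (M : Env H → E → Measure E) (W : Env H → E → ℝ)
    (hQk : ∀ ω, Measurable (Qk M W ω)) (hQn : ∀ n ω, Measurable (Qn M W n ω))
    (εm εp : ℝ) (hεm : 0 < εm) (hεmp : εm ≤ εp)
    (ν : Measure E) [IsProbabilityMeasure ν]
    (hB2b : ∀ ω x, ∀ A : Set E, MeasurableSet A →
        ENNReal.ofReal εm * ν A ≤ M ω x A ∧ M ω x A ≤ ENNReal.ofReal εp * ν A)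
    (hB2d : ∀ n : ℕ, ∀ ω, ∀ σ : Measure E, IsProbabilityMeasure σ →
        0 < QnMass M W n ω σ ∧ QnMass M W n ω σ < ∞)
    (σ : Measure E) (hσ : IsProbabilityMeasure σ)
    (φ : E → ℝ≥0∞) (hφ : Measurable φ) (a b : ℝ) (ha : 0 ≤ a) (hab : a ≤ b)
    (h1 : ∀ y, ENNReal.ofReal a ≤ φ y) (h2 : ∀ y, φ y ≤ ENNReal.ofReal b) (n : ℕ) (ω : Env H) :
    ∃ a' b' : ℝ, a ≤ a' ∧ a' ≤ b' ∧ b' ≤ b ∧ b' - a' ≤ (1 - εm / εp) ^ n * (b - a) ∧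
      ∀ N, n ≤ N → ENNReal.ofReal a' ≤ PhiFun M W N (zitInv N ω) σ φ ∧
        PhiFun M W N (zitInv N ω) σ φ ≤ ENNReal.ofReal b' := by
  obtain ⟨a', b', h3, h4, h5, h6, h7⟩ := aux_contr M W hQk hQn εm εp hεm hεmp ν hB2b hB2d
    φ hφ a b ha hab h1 h2 n (zitInv n ω)
  refine ⟨a', b', h3, h4, h5, h6, fun N hN => ?_⟩
  obtain ⟨m, rfl⟩ := Nat.exists_eq_add_of_le hN
  obtain ⟨hp, hf⟩ := hB2d (n + m) (zitInv (n + m) ω) σ hσ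
  have e : σ.bind (Qn M W (n + m) (zitInv (n + m) ω)) =
      (σ.bind (Qn M W m (zitInv (n + m) ω))).bind (Qn M W n (zitInv n ω)) := by
    rw [Measure.bind_bind (hQn _ _).aemeasurable (hQn _ _).aemeasurable]
    congr 1
    funext x
    rw [add_comm n m, aux_Qn_add M W hQk hQn, add_comm m n, aux_zit_zitInv]
  rw [PhiFun, ENNReal.le_div_iff_mul_le (Or.inl hp.ne') (Or.inl hf.ne),
    ENNReal.div_le_iff hp.ne' hf.ne, QnMass, e,
    Measure.lintegral_bind (hQn _ _).aemeasurable hφ.aemeasurable,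
    Measure.bind_apply .univ (hQn _ _).aemeasurable]
  have hG : Measurable fun y => Qn M W n (zitInv n ω) y Set.univ :=
      (Measure.measurable_coe .univ).comp (hQn _ _)
  rw [← lintegral_const_mul _ hG, ← lintegral_const_mul _ hG]
  exact ⟨lintegral_mono fun x => (h7 x).1, lintegral_mono fun x => (h7 x).2⟩

lemma aux_dom (M : Env H → E → Measure E) (W : Env H → E → ℝ)
    (hQk : ∀ ω, Measurable (Qk M W ω)) (hQn : ∀ n ω, Measurable (Qn M W n ω))
    (hMprob : ∀ ω x, IsProbabilityMeasure (M ω x))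
    (εp : ℝ) (ν : Measure E)
    (hB2b : ∀ ω x, ∀ A : Set E, MeasurableSet A → M ω x A ≤ ENNReal.ofReal εp * ν A)
    (hB2d : ∀ n : ℕ, ∀ ω, ∀ σ : Measure E, IsProbabilityMeasure σ →
        0 < QnMass M W n ω σ ∧ QnMass M W n ω σ < ∞)
    (σ : Measure E) (hσ : IsProbabilityMeasure σ) (n : ℕ) (ω : Env H)
    (A : Set E) (hA : MeasurableSet A) :
    PhiSet M W (n + 1) ω σ A ≤ ENNReal.ofReal εp * ν A := by
  obtain ⟨hp, hf⟩ := hB2d (n + 1) ω σ hσ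
  have key : ∀ x, Qn M W (n + 1) ω x A ≤
      ENNReal.ofReal εp * ν A * Qn M W (n + 1) ω x Set.univ := by
    intro x
    have hG : Measurable fun y => Qk M W (zit n ω) y Set.univ :=
      (Measure.measurable_coe .univ).comp (hQk _)
    rw [Qn, Measure.bind_apply hA (hQk _).aemeasurable,
      Measure.bind_apply .univ (hQk _).aemeasurable, ← lintegral_const_mul _ hG]
    refine lintegral_mono fun y => ?_
    simp only [Qk, Measure.smul_apply, smul_eq_mul, measure_univ, mul_one]
    rw [mul_comm]
    gcongr
    exact hB2b _ _ A hA
  have hG : Measurable fun y => Qn M W (n + 1) ω y Set.univ :=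
      (Measure.measurable_coe .univ).comp (hQn _ _)
  rw [PhiSet, ENNReal.div_le_iff hp.ne' hf.ne, QnMass,
    Measure.bind_apply hA (hQn _ _).aemeasurable,
    Measure.bind_apply .univ (hQn _ _).aemeasurable, ← lintegral_const_mul _ hG]
  exact lintegral_mono key

lemma aux_real (D γ a b α β p q P κ : ℝ) (hD : 0 < D) (hγ : 0 < γ)
    (ha : γ / D ≤ a) (hα : 0 < α) (hκ : 1 ≤ κ) (hβ : β ≤ κ * α)
    (hP1 : a ≤ P) (hP2 : P ≤ b)
    (hp1 : α * P ≤ p) (hp2 : p ≤ β * P) (hq1 : α * γ ≤ q) (hq2 : q ≤ β * γ) :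
    a / γ / κ ≤ p / q ∧ p / q ≤ κ * (b / γ) := by
  have ha0 : 0 < a := lt_of_lt_of_le (by positivity) ha
  have hP0 : 0 < P := by linarith
  have hq : 0 < q := lt_of_lt_of_le (by positivity) hq1
  have hκ0 : 0 < κ := by linarith
  constructor
  · rw [div_div, div_le_div_iff₀ (by positivity) hq]
    calc a * q ≤ P * (κ * α * γ) := by
          apply mul_le_mul hP1 (hq2.trans (by gcongr)) hq.le hP0.le
      _ = (α * P) * (γ * κ) := by ring
      _ ≤ _ := by gcongr
  · rw [← mul_div_assoc, div_le_div_iff₀ hq hγ]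
    calc p * γ ≤ (κ * α * b) * γ := by
          gcongr
          exact hp2.trans (mul_le_mul hβ hP2 hP0.le (by positivity))
      _ = κ * b * (α * γ) := by ring
      _ ≤ _ := by
          have hb0 : 0 ≤ b := hP0.le.trans hP2
          gcongr

lemma aux_ratio (M : Env H → E → Measure E) (W : Env H → E → ℝ)
    (hQk : ∀ ω, Measurable (Qk M W ω)) (hQn : ∀ n ω, Measurable (Qn M W n ω))
    (εm εp : ℝ) (hεm : 0 < εm) (hεmp : εm ≤ εp)
    (ν : Measure E) [IsProbabilityMeasure ν]
    (hB2b : ∀ ω x, ∀ A : Set E, MeasurableSet A →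
        ENNReal.ofReal εm * ν A ≤ M ω x A ∧ M ω x A ≤ ENNReal.ofReal εp * ν A)
    (D : ℝ) (hD : 0 < D)
    (hB2c : ∀ n : ℕ, 1 ≤ n → ∀ ω, ∀ σ₁ σ₂ : Measure E,
        IsProbabilityMeasure σ₁ → IsProbabilityMeasure σ₂ →
        QnMass M W n ω σ₁ ≤ ENNReal.ofReal D * QnMass M W n ω σ₂)
    (hB2d : ∀ n : ℕ, ∀ ω, ∀ σ : Measure E, IsProbabilityMeasure σ →
        0 < QnMass M W n ω σ ∧ QnMass M W n ω σ < ∞)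
    (σ : Measure E) (hσ : IsProbabilityMeasure σ) (ω : Env H) (x : E) :
    ∃ L, Tendsto (fun n : ℕ => (ratioH M W σ n ω x).toReal) atTop (𝓝 L) := by
  have hdir : ∀ n ω x, QnMass M W n ω (Measure.dirac x) = Qn M W n ω x Set.univ := by
    intro n ω x
    rw [QnMass, Measure.dirac_bind (hQn _ _)]
  have hpos : ∀ n ω x, 0 < (Qn M W n ω x Set.univ).toReal := by
    intro n ω x
    obtain ⟨h1, h2⟩ := hB2d n ω (Measure.dirac x) inferInstance
    rw [hdir] at h1 h2
    exact ENNReal.toReal_pos h1.ne' h2.ne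
  have hof : ∀ n ω x, Qn M W n ω x Set.univ = ENNReal.ofReal (Qn M W n ω x Set.univ).toReal := by
    intro n ω x
    obtain ⟨h1, h2⟩ := hB2d n ω (Measure.dirac x) inferInstance
    rw [hdir] at h1 h2
    exact (ENNReal.ofReal_toReal h2.ne).symm
  have hcmp : ∀ n, 1 ≤ n → ∀ ω x y, (Qn M W n ω x Set.univ).toReal ≤
      D * (Qn M W n ω y Set.univ).toReal := by
    intro n hn ω x y
    have := hB2c n hn ω (Measure.dirac x) (Measure.dirac y) inferInstance inferInstance
    rw [hdir, hdir, hof n ω x, hof n ω y, ← ENNReal.ofReal_mul hD.le,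
      ENNReal.ofReal_le_ofReal_iff (mul_nonneg hD.le (hpos _ _ _).le)] at this
    exact this
  have hGm : ∀ n ω, Measurable fun y => Qn M W n ω y Set.univ := fun n ω =>
      (Measure.measurable_coe .univ).comp (hQn _ _)
  have hD1 : 1 ≤ D := by
    have h1 := hcmp 1 le_rfl ω x x
    have h2 := hpos 1 ω x
    by_contra h
    nlinarith
  have hbd : ∀ n, 1 ≤ n → ∀ ω y,
      ENNReal.ofReal ((Qn M W n ω x Set.univ).toReal / D) ≤ Qn M W n ω y Set.univ ∧
      Qn M W n ω y Set.univ ≤ ENNReal.ofReal (D * (Qn M W n ω x Set.univ).toReal) := by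
    intro n hn ω y
    rw [hof n ω y]
    refine ⟨ENNReal.ofReal_le_ofReal ?_, ENNReal.ofReal_le_ofReal ?_⟩
    · rw [div_le_iff₀ hD, mul_comm]; exact hcmp n hn ω x y
    · exact hcmp n hn ω y x
  have hle : ∀ n ω, (Qn M W n ω x Set.univ).toReal / D ≤ D * (Qn M W n ω x Set.univ).toReal := by
    intro n ω
    have := hpos n ω x
    calc _ ≤ (Qn M W n ω x Set.univ).toReal := div_le_self this.le hD1
      _ ≤ _ := le_mul_of_one_le_left this.le hD1
  set s : ℕ → ℝ := fun N => (PhiFun M W N (zitInv N ω) σ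
    (fun y => Qn M W N ω y Set.univ)).toReal / (Qn M W N ω x Set.univ).toReal with hs
  have hεp : 0 < εp := hεm.trans_le hεmp
  have hρ0 : 0 ≤ 1 - εm / εp := sub_nonneg.2 ((div_le_one hεp).2 hεmp)
  have hρ1 : 1 - εm / εp < 1 := by have : 0 < εm / εp := by positivity
                                   linarith
  set ρ := 1 - εm / εp with hρ
  set κ : ℕ → ℝ := fun n => 1 + ρ ^ n * D ^ 2 with hκ
  have hκ1 : ∀ n, 1 ≤ κ n := fun n => by simp only [hκ]; nlinarith [pow_nonneg hρ0 n, sq_nonneg D]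
  have main : ∀ n, 1 ≤ n → ∃ l u, 0 < l ∧
      u - l ≤ κ n * (ρ ^ n * D) + D * (κ n - (κ n)⁻¹) ∧
      ∀ᶠ N in atTop, l ≤ s N ∧ s N ≤ u := by
    intro n hn
    set γ := (Qn M W n ω x Set.univ).toReal with hγ
    have hγ0 : 0 < γ := hpos n ω x
    obtain ⟨a, b, h1, h2, h3, h4, h5⟩ := aux_phi M W hQk hQn εm εp hεm hεmp ν hB2b hB2d σ hσ
      (fun y => Qn M W n ω y Set.univ) (hGm n ω) (γ / D) (D * γ) (by positivity) (hle n ω)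
      (fun y => (hbd n hn ω y).1) (fun y => (hbd n hn ω y).2) n ω
    have ha0 : 0 < a := lt_of_lt_of_le (by positivity) h1
    have hκ0 : 0 < κ n := by linarith [hκ1 n]
    refine ⟨a / γ / κ n, κ n * (b / γ), by positivity, ?_, ?_⟩
    · have e1 : b / γ - a / γ ≤ ρ ^ n * D := by
        rw [← sub_div, div_le_iff₀ hγ0]
        refine h4.trans ?_
        rw [mul_assoc]
        apply mul_le_mul_of_nonneg_left _ (pow_nonneg hρ0 n)
        have : 0 < γ / D := by positivity
        linarith
      have e2 : a / γ ≤ D := by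
        rw [div_le_iff₀ hγ0]; linarith
      have e3 : (κ n)⁻¹ ≤ κ n := (inv_le_one_of_one_le₀ (hκ1 n)).trans (hκ1 n)
      have e4 := mul_le_mul_of_nonneg_left e1 hκ0.le
      have e5 := mul_le_mul_of_nonneg_right e2 (sub_nonneg.2 e3)
      rw [div_eq_mul_inv (a / γ) (κ n)]
      linarith
    · filter_upwards [eventually_ge_atTop (n + 1)] with N hN
      obtain ⟨m, rfl⟩ := Nat.exists_eq_add_of_le (show n ≤ N by omega)
      have hm : 1 ≤ m := by omega
      set f := (Qn M W m (zit n ω) x Set.univ).toReal with hf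
      have hf0 : 0 < f := hpos m _ x
      obtain ⟨α, β, g1, g2, g3, g4, g5⟩ := aux_contr M W hQk hQn εm εp hεm hεmp ν hB2b hB2d
        (fun y => Qn M W m (zit n ω) y Set.univ) (hGm m _) (f / D) (D * f) (by positivity)
        (hle m _) (fun y => (hbd m hm _ y).1) (fun y => (hbd m hm _ y).2) n ω
      have hα0 : 0 < α := lt_of_lt_of_le (by positivity) g1
      have hβ0 : 0 < β := hα0.trans_le g2
      have hN' : ∀ y, Qn M W (n + m) ω y Set.univ =
          ∫⁻ u, Qn M W m (zit n ω) u Set.univ ∂(Qn M W n ω y) := by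
        intro y
        rw [aux_Qn_add M W hQk hQn, Measure.bind_apply .univ (hQn _ _).aemeasurable]
      simp only [← hN'] at g5
      obtain ⟨p1, p2⟩ := h5 (n + m) (by omega)
      have hPt : PhiFun M W (n + m) (zitInv (n + m) ω) σ (fun y => Qn M W n ω y Set.univ) ≠ ∞ :=
        ne_top_of_le_ne_top ENNReal.ofReal_ne_top p2
      have q1 : ENNReal.ofReal α *
          PhiFun M W (n + m) (zitInv (n + m) ω) σ (fun y => Qn M W n ω y Set.univ) ≤
          PhiFun M W (n + m) (zitInv (n + m) ω) σ (fun y => Qn M W (n + m) ω y Set.univ) := by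
        rw [PhiFun, PhiFun, ← mul_div_assoc, ← lintegral_const_mul _ (hGm _ _)]
        exact ENNReal.div_le_div_right (lintegral_mono fun y => (g5 y).1) _
      have q2 : PhiFun M W (n + m) (zitInv (n + m) ω) σ (fun y => Qn M W (n + m) ω y Set.univ) ≤
          ENNReal.ofReal β *
          PhiFun M W (n + m) (zitInv (n + m) ω) σ (fun y => Qn M W n ω y Set.univ) := by
        rw [PhiFun, PhiFun, ← mul_div_assoc, ← lintegral_const_mul _ (hGm _ _)]
        exact ENNReal.div_le_div_right (lintegral_mono fun y => (g5 y).2) _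
      have hpt := ne_top_of_le_ne_top (ENNReal.mul_ne_top ENNReal.ofReal_ne_top hPt) q2
      obtain ⟨r1, r2⟩ := g5 x
      rw [hof (n + m) ω x, hof n ω x, ← ENNReal.ofReal_mul hα0.le,
        ENNReal.ofReal_le_ofReal_iff (hpos _ _ _).le] at r1
      rw [hof (n + m) ω x, hof n ω x, ← ENNReal.ofReal_mul hβ0.le,
        ENNReal.ofReal_le_ofReal_iff (mul_nonneg hβ0.le (hpos _ _ _).le)] at r2
      refine aux_real D γ a b α β _ _
        (PhiFun M W (n + m) (zitInv (n + m) ω) σ (fun y => Qn M W n ω y Set.univ)).toReal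
        (κ n) hD hγ0 h1 hα0 (hκ1 n) ?_ ?_ ?_ ?_ ?_ r1 r2
      · have e1 : f ≤ D * α := by rw [div_le_iff₀ hD] at g1; linarith
        have e2 : D * f - f / D ≤ D ^ 2 * α := by
          have : 0 < f / D := by positivity
          nlinarith
        have e3 := mul_le_mul_of_nonneg_left e2 (pow_nonneg hρ0 n)
        simp only [hκ]
        linarith
      · exact (ENNReal.ofReal_le_iff_le_toReal hPt).1 p1
      · exact ENNReal.toReal_le_of_le_ofReal (by linarith) p2
      · have := ENNReal.toReal_mono hpt q1
        rwa [ENNReal.toReal_mul, ENNReal.toReal_ofReal hα0.le] at this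
      · have := ENNReal.toReal_mono (ENNReal.mul_ne_top ENNReal.ofReal_ne_top hPt) q2
        rwa [ENNReal.toReal_mul, ENNReal.toReal_ofReal hβ0.le] at this
  have hρt : Tendsto (fun n : ℕ => ρ ^ n) atTop (𝓝 0) :=
    tendsto_pow_atTop_nhds_zero_of_lt_one hρ0 hρ1
  have hκt : Tendsto κ atTop (𝓝 1) := by
    simpa [hκ] using (hρt.mul_const (D ^ 2)).const_add 1
  obtain ⟨L, hL⟩ := aux_seq s (fun n => κ n * (ρ ^ n * D) + D * (κ n - (κ n)⁻¹))
    (by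
      have t1 := hκt.mul (hρt.mul_const D)
      have t2 := (hκt.sub (hκt.inv₀ one_ne_zero)).const_mul D
      simpa using t1.add t2)
    (by
      filter_upwards [eventually_ge_atTop 1] with n hn
      obtain ⟨l, u, -, h1, h2⟩ := main n hn
      exact ⟨l, u, h1, h2⟩)
  obtain ⟨l, u, hl, -, h2⟩ := main 1 le_rfl
  have hL0 : l ≤ L := ge_of_tendsto hL (h2.mono fun N h => h.1)
  refine ⟨L⁻¹, (hL.inv₀ (by linarith)).congr fun N => ?_⟩
  simp only [hs]
  rw [ratioH, ENNReal.toReal_div, inv_div]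

/-- **Proposition 2, parts 1–2 (fixed `σ`).** Assuming (B2), for every `ω` the limits
`η^ω(A) = lim_n Φ_n^{z^{-n}ω}(σ)(A)` and
`h(ω,x) = lim_n Q_n^ω(1)(x)/Φ_n^{z^{-n}ω}(σ)(Q_n^ω(1))` exist, `η^ω` being a
probability measure measurable in `ω`, and `h` being jointly measurable. -/
theorem proposition2_fixed_sigma
    (M : Env H → E → Measure E) (W : Env H → E → ℝ)
    (hMprob : ∀ ω x, IsProbabilityMeasure (M ω x))
    (hMmeas : Measurable fun p : Env H × E => M p.1 p.2)
    (hWmeas : Measurable fun p : Env H × E => W p.1 p.2)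
    (hWnn : ∀ ω x, 0 ≤ W ω x) (CW : ℝ) (hWbdd : ∀ ω x, W ω x ≤ CW)
    -- (B2)
    (Δ1 : ℝ) (hΔ1 : 0 < Δ1)
    (hB2a : ∀ ω x u, ∫⁻ y, ENNReal.ofReal (W (shift ω) y) ∂(M ω x)
        ≤ ENNReal.ofReal Δ1 * ∫⁻ y, ENNReal.ofReal (W (shift ω) y) ∂(M ω u))
    (εm εp : ℝ) (hεm : 0 < εm) (hεmp : εm ≤ εp)
    (ν : Measure E) [IsProbabilityMeasure ν]
    (hB2b : ∀ ω x, ∀ A : Set E, MeasurableSet A →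
        ENNReal.ofReal εm * ν A ≤ M ω x A ∧ M ω x A ≤ ENNReal.ofReal εp * ν A)
    (Δ2 : ℝ) (hΔ2 : 0 < Δ2)
    (hB2c : ∀ n : ℕ, 1 ≤ n → ∀ ω, ∀ σ₁ σ₂ : Measure E,
        IsProbabilityMeasure σ₁ → IsProbabilityMeasure σ₂ →
        QnMass M W n ω σ₁ ≤ ENNReal.ofReal Δ2 * QnMass M W n ω σ₂)
    (hB2d : ∀ n : ℕ, 1 ≤ n → ∀ ω, ∀ σ : Measure E, IsProbabilityMeasure σ →
        0 < QnMass M W n ω σ ∧ QnMass M W n ω σ < ∞)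
    -- fix a probability measure σ on E
    (σ : Measure E) (hσ : IsProbabilityMeasure σ) :
    ∃ η : Env H → Measure E,
      (∀ ω, IsProbabilityMeasure (η ω)) ∧
      (∀ A : Set E, MeasurableSet A → Measurable fun ω => η ω A) ∧
      (∀ ω, ∀ A : Set E, MeasurableSet A →
        Tendsto (fun n : ℕ => PhiSet M W n (zitInv n ω) σ A) atTop (𝓝 (η ω A))) ∧
      ∃ h : Env H → E → ℝ,
        Measurable (fun p : Env H × E => h p.1 p.2) ∧
        ∀ ω x, Tendsto (fun n : ℕ => (ratioH M W σ n ω x).toReal)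
          atTop (𝓝 (h ω x)) := by
  have hQkj := aux_Qk_meas M W hMmeas hWmeas
  have hQnj := aux_Qn_joint M W hMprob hMmeas hWmeas CW hWbdd
  have hQk : ∀ ω, Measurable (Qk M W ω) := fun ω => hQkj.comp measurable_prodMk_left
  have hQn : ∀ n ω, Measurable (Qn M W n ω) := fun n ω => (hQnj n).comp measurable_prodMk_left
  have hd : ∀ n : ℕ, ∀ ω, ∀ σ : Measure E, IsProbabilityMeasure σ →
        0 < QnMass M W n ω σ ∧ QnMass M W n ω σ < ∞ := by
    intro n ω σ hσ
    rcases Nat.eq_zero_or_pos n with rfl | hn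
    · have : Qn M W 0 ω = Measure.dirac := rfl
      rw [QnMass, this, Measure.bind_dirac]
      simp
    · exact hB2d n hn ω σ hσ
  have hεp : 0 < εp := hεm.trans_le hεmp
  have hρ0 : 0 ≤ 1 - εm / εp := sub_nonneg.2 ((div_le_one hεp).2 hεmp)
  have hρ1 : 1 - εm / εp < 1 := sub_lt_self _ (by positivity)
  have hlim : ∀ ω A, MeasurableSet A →
      ∃ L, Tendsto (fun n : ℕ => PhiSet M W n (zitInv n ω) σ A) atTop (𝓝 L) := by
    intro ω A hA
    have hfun : ∀ n ω, PhiSet M W n ω σ A = PhiFun M W n ω σ (A.indicator 1) := by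
      intro n ω
      rw [PhiSet, PhiFun, lintegral_indicator_one hA]
    have key := fun n => aux_phi M W hQk hQn εm εp hεm hεmp ν hB2b hd σ hσ
      (A.indicator 1) (measurable_one.indicator hA) 0 1 le_rfl zero_le_one
      (fun y => by simp) (fun y => by
        by_cases hy : y ∈ A <;> simp [hy]) n ω
    have hfin : ∀ n, PhiSet M W n (zitInv n ω) σ A ≠ ∞ := by
      intro n
      obtain ⟨a, b, -, -, -, -, h⟩ := key 0
      rw [hfun]
      exact ne_top_of_le_ne_top ENNReal.ofReal_ne_top (h n (Nat.zero_le _)).2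
    obtain ⟨L, hL⟩ := aux_seq (fun n => (PhiSet M W n (zitInv n ω) σ A).toReal)
      (fun n => (1 - εm / εp) ^ n) (tendsto_pow_atTop_nhds_zero_of_lt_one hρ0 hρ1)
      (Eventually.of_forall fun n => by
        obtain ⟨a, b, h1, h2, h3, h4, h⟩ := key n
        refine ⟨a, b, by simpa using h4, ?_⟩
        filter_upwards [eventually_ge_atTop n] with N hN
        obtain ⟨p1, p2⟩ := h N hN
        rw [← hfun] at p1 p2
        exact ⟨(ENNReal.ofReal_le_iff_le_toReal (hfin N)).1 p1,
          ENNReal.toReal_le_of_le_ofReal (h1.trans h2) p2⟩)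
    refine ⟨ENNReal.ofReal L, (ENNReal.tendsto_ofReal hL).congr fun n => ?_⟩
    exact ENNReal.ofReal_toReal (hfin n)
  choose! L hL using hlim
  have hempty : ∀ ω, L ω ∅ = 0 := by
    intro ω
    refine tendsto_nhds_unique (hL ω ∅ .empty) ?_
    simp [PhiSet]
  have huniv : ∀ ω, L ω Set.univ = 1 := by
    intro ω
    refine tendsto_nhds_unique (hL ω _ .univ) (tendsto_const_nhds.congr fun n => ?_)
    obtain ⟨h1, h2⟩ := hd n (zitInv n ω) σ hσ
    rw [PhiSet, ← QnMass, ENNReal.div_self h1.ne' h2.ne]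
  have hadd : ∀ ω, ∀ ⦃f : ℕ → Set E⦄, (∀ i, MeasurableSet (f i)) →
      Pairwise (Function.onFun Disjoint f) → L ω (⋃ i, f i) = ∑' i, L ω (f i) := by
    intro ω f hf hdis
    have t1 := (tendsto_add_atTop_iff_nat 1).2 (hL ω _ (MeasurableSet.iUnion hf))
    have t2 : Tendsto (fun n : ℕ => ∫⁻ i, PhiSet M W (n + 1) (zitInv (n + 1) ω) σ (f i)
        ∂(Measure.count : Measure ℕ)) atTop (𝓝 (∫⁻ i, L ω (f i) ∂(Measure.count : Measure ℕ))) := by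
      refine tendsto_lintegral_of_dominated_convergence
        (fun i => ENNReal.ofReal εp * ν (f i)) (fun n => measurable_of_countable _)
        (fun n => Eventually.of_forall fun i => ?_) ?_ (Eventually.of_forall fun i => ?_)
      · exact aux_dom M W hQk hQn hMprob εp ν (fun ω x A hA => (hB2b ω x A hA).2) hd σ hσ
          n _ _ (hf i)
      · rw [lintegral_count, ENNReal.tsum_mul_left, ← measure_iUnion hdis hf]
        exact ENNReal.mul_ne_top ENNReal.ofReal_ne_top (measure_ne_top _ _)
      · exact (tendsto_add_atTop_iff_nat 1).2 (hL ω _ (hf i))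
    simp only [lintegral_count] at t2
    refine tendsto_nhds_unique t1 (t2.congr fun n => ?_)
    simp only [PhiSet, div_eq_mul_inv]
    rw [ENNReal.tsum_mul_right, ← measure_iUnion hdis hf]
  have hmassm : ∀ (n : ℕ) (A : Set E), MeasurableSet A →
      Measurable fun ω => (σ.bind (Qn M W n ω)) A := by
    intro n A hA
    have : (fun ω => (σ.bind (Qn M W n ω)) A) = fun ω => ∫⁻ x, Qn M W n ω x A ∂σ := by
      funext ω
      rw [Measure.bind_apply hA (hQn _ _).aemeasurable]
    rw [this]
    exact Measurable.lintegral_prod_right'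
      (f := fun p : Env H × E => Qn M W n p.1 p.2 A) ((Measure.measurable_coe hA).comp (hQnj n))
  have hηA : ∀ ω A, MeasurableSet A → Measure.ofMeasurable (fun A _ => L ω A) (hempty ω)
      (hadd ω) A = L ω A := fun ω A hA => Measure.ofMeasurable_apply A hA
  refine ⟨fun ω => Measure.ofMeasurable (fun A _ => L ω A) (hempty ω) (hadd ω),
    fun ω => ⟨?_⟩, fun A hA => ?_, fun ω A hA => ?_, ?_⟩
  · rw [hηA ω _ .univ, huniv]
  · simp only [fun ω => hηA ω A hA]
    refine measurable_of_tendsto_metrizable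
      (f := fun n ω => PhiSet M W n (zitInv n ω) σ A) (fun n => ?_)
      (tendsto_pi_nhds.2 fun ω => hL ω A hA)
    exact ((hmassm n A hA).comp (aux_zitInv_meas n)).div
      ((hmassm n Set.univ .univ).comp (aux_zitInv_meas n))
  · rw [hηA ω A hA]
    exact hL ω A hA
  · have hr := aux_ratio M W hQk hQn εm εp hεm hεmp ν hB2b Δ2 hΔ2 hB2c hd σ hσ
    choose h hh using hr
    refine ⟨h, ?_, hh⟩
    refine measurable_of_tendsto_metrizable
      (f := fun n (p : Env H × E) => (ratioH M W σ n p.1 p.2).toReal) (fun n => ?_)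
      (tendsto_pi_nhds.2 fun p => hh p.1 p.2)
    refine Measurable.ennreal_toReal ?_
    have e : ∀ ω, ∫⁻ y, Qn M W n ω y Set.univ ∂(σ.bind (Qn M W n (zitInv n ω))) =
        (σ.bind (Qn M W (n + n) (zitInv n ω))) Set.univ := by
      intro ω
      have hz : zit n (zitInv n ω) = ω := by
        have := aux_zit_zitInv 0 n ω
        rwa [Nat.zero_add] at this
      have hb : Qn M W (n + n) (zitInv n ω) =
          fun x => (Qn M W n (zitInv n ω) x).bind (Qn M W n ω) := by
        funext x
        rw [aux_Qn_add M W hQk hQn, hz]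
      rw [hb, ← Measure.bind_bind (hQn _ _).aemeasurable (hQn _ _).aemeasurable,
        Measure.bind_apply .univ (hQn _ _).aemeasurable]
    simp only [ratioH, PhiFun, e, QnMass]
    refine ((Measure.measurable_coe .univ).comp (hQnj n)).div (Measurable.div ?_ ?_)
    · exact (hmassm (n + n) Set.univ .univ).comp ((aux_zitInv_meas n).comp measurable_fst)
    · exact (hmassm n Set.univ .univ).comp ((aux_zitInv_meas n).comp measurable_fst)

end
end

section
/- Assume (B2) and assume additionally that there is a constant g̲ > 0 such that Q^ω(x,A) ≥ g̲·ν(A) for all (ω,x) ∈ Ω×E and A ∈ 𝓔 (for example g̲ = ε_-·inf_{(ω,x)}W(ω,x) when inf W > 0). Define κ_n^ω = νQ_{n−1}^ω(1)·g̲ for n ≥ 1 (with Q_0 the identity, so κ_1^ω = g̲). Then for all integers n, p ≥ 1 and all ω ∈ Ω: κ_{n+p}^ω ≥ κ_p^ω·κ_n^{z^pω}; equivalently, −log κ_{n+p}^ω ≤ −log κ_p^ω − log κ_n^{z^pω}. -/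
open MeasureTheory ENNReal Filter Topology

noncomputable section

variable {H E : Type*} [MeasurableSpace H] [MeasurableSpace E]

/-- `κ_n^ω = νQ_{n−1}^ω(1)·g̲`. -/
def kap (M : Env H → E → Measure E) (W : Env H → E → ℝ) (ν : Measure E) (g : ℝ)
    (n : ℕ) (ω : Env H) : ℝ≥0∞ :=
  (ν.bind (Qn M W (n - 1) ω)) Set.univ * ENNReal.ofReal g

theorem aux_meas_Qk (M : Env H → E → Measure E) (W : Env H → E → ℝ)
    (hMmeas : Measurable fun p : Env H × E => M p.1 p.2)
    (hWmeas : Measurable fun p : Env H × E => W p.1 p.2) (ω : Env H) :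
    Measurable (Qk M W ω) := by
  have h1 : Measurable (M ω) := hMmeas.comp (measurable_const.prodMk measurable_id)
  have h2 : Measurable (W ω) := hWmeas.comp (measurable_const.prodMk measurable_id)
  refine Measure.measurable_of_measurable_coe _ fun s hs => ?_
  simp only [Qk, Measure.smul_apply, smul_eq_mul]
  exact h2.ennreal_ofReal.mul ((Measure.measurable_coe hs).comp h1)

theorem aux_meas_Qn (M : Env H → E → Measure E) (W : Env H → E → ℝ)
    (hQ : ∀ ω, Measurable (Qk M W ω)) (n : ℕ) (ω : Env H) :
    Measurable (Qn M W n ω) := by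
  induction n with
  | zero => exact Measure.measurable_dirac
  | succ n ih => exact (Measure.measurable_bind' (hQ (zit n ω))).comp ih

theorem aux_bind_succ (M : Env H → E → Measure E) (W : Env H → E → ℝ)
    (hQ : ∀ ω, Measurable (Qk M W ω)) (n : ℕ) (ω : Env H) (μ : Measure E) :
    μ.bind (Qn M W (n + 1) ω) = (μ.bind (Qn M W n ω)).bind (Qk M W (zit n ω)) := by
  rw [Measure.bind_bind (aux_meas_Qn M W hQ n ω).aemeasurable (hQ _).aemeasurable]
  rfl

theorem aux_zit_add (p m : ℕ) (ω : Env H) : zit (p + m) ω = zit m (zit p ω) := by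
  induction m with
  | zero => rfl
  | succ m ih => 
    rw [← Nat.add_assoc]
    simp only [zit, ih]

theorem aux_bind_add (M : Env H → E → Measure E) (W : Env H → E → ℝ)
    (hQ : ∀ ω, Measurable (Qk M W ω)) (p m : ℕ) (ω : Env H) (μ : Measure E) :
    μ.bind (Qn M W (p + m) ω) = (μ.bind (Qn M W p ω)).bind (Qn M W m (zit p ω)) := by
  induction m with
  | zero => exact Measure.bind_dirac.symm
  | succ m ih =>
    rw [← Nat.add_assoc, aux_bind_succ M W hQ, ih, aux_bind_succ M W hQ, aux_zit_add]

theorem aux_step (M : Env H → E → Measure E) (W : Env H → E → ℝ)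
    (hQ : ∀ ω, Measurable (Qk M W ω)) (ν : Measure E) (g : ℝ)
    (hQg : ∀ ω x, ∀ A : Set E, MeasurableSet A →
        ENNReal.ofReal g * ν A ≤ Qk M W ω x A) (ω : Env H) (μ : Measure E) :
    (μ Set.univ * ENNReal.ofReal g) • ν ≤ μ.bind (Qk M W ω) := by
  refine Measure.le_iff.2 fun A hA => ?_
  rw [Measure.bind_apply hA (hQ ω).aemeasurable, Measure.smul_apply, smul_eq_mul]
  calc μ Set.univ * ENNReal.ofReal g * ν A = ∫⁻ _, ENNReal.ofReal g * ν A ∂μ := by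
        rw [lintegral_const]; ring
    _ ≤ _ := lintegral_mono fun x => hQg ω x A hA

/-- **Supermultiplicativity of `κ` (from the proof of Proposition 1).** Assume (B2)
and that `Q^ω(x,·) ≥ g̲·ν(·)` for a constant `g̲ > 0`. Then
`κ_{n+p}^ω ≥ κ_p^ω·κ_n^{z^pω}`, equivalently
`−log κ_{n+p}^ω ≤ −log κ_p^ω − log κ_n^{z^pω}`. -/
theorem kappa_supermultiplicative
    (M : Env H → E → Measure E) (W : Env H → E → ℝ)
    (hMprob : ∀ ω x, IsProbabilityMeasure (M ω x))
    (hMmeas : Measurable fun p : Env H × E => M p.1 p.2)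
    (hWmeas : Measurable fun p : Env H × E => W p.1 p.2)
    (hWnn : ∀ ω x, 0 ≤ W ω x) (CW : ℝ) (hWbdd : ∀ ω x, W ω x ≤ CW)
    -- (B2), minorisation/majorisation part
    (εm εp : ℝ) (hεm : 0 < εm) (hεmp : εm ≤ εp)
    (ν : Measure E) [IsProbabilityMeasure ν]
    (hB2b : ∀ ω x, ∀ A : Set E, MeasurableSet A →
        ENNReal.ofReal εm * ν A ≤ M ω x A ∧ M ω x A ≤ ENNReal.ofReal εp * ν A)
    -- the minorisation of Q by g̲·ν
    (g : ℝ) (hg : 0 < g)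
    (hQg : ∀ ω x, ∀ A : Set E, MeasurableSet A →
        ENNReal.ofReal g * ν A ≤ Qk M W ω x A) :
    ∀ n p : ℕ, 1 ≤ n → 1 ≤ p → ∀ ω : Env H,
      kap M W ν g p ω * kap M W ν g n (zit p ω) ≤ kap M W ν g (n + p) ω ∧
      -Real.log ((kap M W ν g (n + p) ω).toReal)
        ≤ -Real.log ((kap M W ν g p ω).toReal)
          - Real.log ((kap M W ν g n (zit p ω)).toReal) := by
  have hQ := aux_meas_Qk M W hMmeas hWmeas
  have hmul : ∀ k q : ℕ, ∀ ω : Env H,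
      kap M W ν g (q + 1) ω * kap M W ν g (k + 1) (zit (q + 1) ω)
        ≤ kap M W ν g (k + 1 + (q + 1)) ω := by
    intro k q ω
    have e : k + 1 + (q + 1) - 1 = (q + 1) + k := by omega
    simp only [kap, Nat.add_sub_cancel]
    rw [e, aux_bind_add M W hQ, ← mul_assoc]
    refine mul_le_mul_left ?_ _
    rw [aux_bind_succ M W hQ q,
      Measure.bind_apply (m := ν) (f := Qn M W k (zit (q + 1) ω)) MeasurableSet.univ
        (aux_meas_Qn M W hQ _ _).aemeasurable,
      Measure.bind_apply (m := (ν.bind (Qn M W q ω)).bind _) MeasurableSet.univ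
        (aux_meas_Qn M W hQ _ _).aemeasurable]
    rw [← smul_eq_mul, ← lintegral_smul_measure]
    exact lintegral_mono' (aux_step M W hQ ν g hQg _ _) le_rfl
  have hmass : ∀ (n : ℕ) (ω : Env H),
      (ν.bind (Qn M W n ω)) Set.univ ≠ 0 ∧ (ν.bind (Qn M W n ω)) Set.univ ≠ ∞ := by
    intro n ω
    induction n with
    | zero =>
      have : ν.bind (Qn M W 0 ω) = ν := Measure.bind_dirac
      rw [this]; simp
    | succ n ih =>
      rw [aux_bind_succ M W hQ]
      constructor
      · have h := aux_step M W hQ ν g hQg (zit n ω) (ν.bind (Qn M W n ω)) Set.univ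
        rw [Measure.smul_apply, smul_eq_mul, measure_univ (μ := ν), mul_one] at h
        intro h0
        rw [h0] at h
        have := nonpos_iff_eq_zero.1 h
        rcases mul_eq_zero.1 this with h1 | h1
        · exact ih.1 h1
        · exact absurd (ENNReal.ofReal_eq_zero.1 h1) (not_le.2 hg)
      · rw [Measure.bind_apply MeasurableSet.univ (hQ _).aemeasurable]
        refine ne_top_of_le_ne_top (ENNReal.mul_ne_top (ENNReal.ofReal_ne_top (r := CW)) ih.2) ?_
        rw [← lintegral_const]
        refine lintegral_mono fun x => ?_
        have := hMprob (zit n ω) x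
        simp only [Qk, Measure.smul_apply, smul_eq_mul, measure_univ, mul_one]
        exact ENNReal.ofReal_le_ofReal (hWbdd _ _)
  have hk : ∀ (n : ℕ) (ω : Env H), kap M W ν g n ω ≠ 0 ∧ kap M W ν g n ω ≠ ∞ := by
    intro n ω
    refine ⟨mul_ne_zero (hmass _ _).1 ?_, ENNReal.mul_ne_top (hmass _ _).2 ENNReal.ofReal_ne_top⟩
    exact fun h1 => absurd (ENNReal.ofReal_eq_zero.1 h1) (not_le.2 hg)
  intro n p hn hp ω
  obtain ⟨k, rfl⟩ := Nat.exists_eq_add_of_le' hn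
  obtain ⟨q, rfl⟩ := Nat.exists_eq_add_of_le' hp
  have h := hmul k q ω
  refine ⟨h, ?_⟩
  have p1 := ENNReal.toReal_pos (hk (q + 1) ω).1 (hk (q + 1) ω).2
  have p2 := ENNReal.toReal_pos (hk (k + 1) (zit (q + 1) ω)).1 (hk (k + 1) (zit (q + 1) ω)).2
  have h2 := ENNReal.toReal_mono (hk (k + 1 + (q + 1)) ω).2 h
  rw [ENNReal.toReal_mul] at h2
  have h3 := Real.log_le_log (mul_pos p1 p2) h2
  rw [Real.log_mul p1.ne' p2.ne'] at h3
  linarith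

end
end
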